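/- Let G be a finitely presented group containing a finitely generated normal subgroup H such that G/H is infinite cyclic. Then H admits an ascending finite endomorphic presentation with two free group endomorphisms; that is, H ≅ F/⟨⟨⋃_{φ ∈ {η,τ}*} φ(R)⟩⟩ for some finitely generated free group F, finite set R ⊆ F, and endomorphisms η, τ of F, where {η,τ}* denotes the monoid generated by η and τ under composition. -/

import Mathlib

/-- `K` has an ascending finite endomorphic presentation (finite L-presentation) with two
free-group endomorphisms: `K ≅ F/⟨⟨⋃_{φ ∈ {η,τ}*} φ(R)⟩⟩` for some finitely generated free
group `F`, finite `R ⊆ F`, and endomorphisms `η, τ` of `F`, where `{η,τ}*` is the monoid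
generated by `η` and `τ` under composition. -/
def HasAscendingFiniteLPresentationTwo (K : Type*) [Group K] : Prop :=
  ∃ (n : ℕ) (R : Finset (FreeGroup (Fin n))) (η τ : Monoid.End (FreeGroup (Fin n))),
    Nonempty (K ≃* FreeGroup (Fin n) ⧸ Subgroup.normalClosure
      {w : FreeGroup (Fin n) |
        ∃ φ ∈ Submonoid.closure ({η, τ} : Set (Monoid.End (FreeGroup (Fin n)))),
          ∃ r ∈ R, w = φ r})

/-- `G` is finitely presented. -/
def IsFinitelyPresentedGroup (G : Type*) [Group G] : Prop :=
  ∃ (n : ℕ) (R : Finset (FreeGroup (Fin n))),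
    Nonempty (G ≃* FreeGroup (Fin n) ⧸
      Subgroup.normalClosure (R : Set (FreeGroup (Fin n))))

/-- The kernel of a surjection from a finitely generated group onto a finitely presented group is
the normal closure of a finite set. -/
theorem MonoidHom.isFinitelyNormallyGenerated_ker {Γ G : Type*} [Group Γ] [Group G]
    [hΓ : Group.FG Γ] [hG : Group.IsFinitelyPresented G] (p : Γ →* G)
    (hp : Function.Surjective p) : p.ker.IsFinitelyNormallyGenerated := by
  obtain ⟨m, φ, hφ, S, hS, hSφ⟩ := hG.out
  obtain ⟨Z, hZ⟩ := hΓ.out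
  choose w hw using fun z : Γ => hφ (p z)
  choose s hs using hp
  let ψ : FreeGroup (Fin m) →* Γ := FreeGroup.lift fun i => s (φ (FreeGroup.of i))
  have hψ : ∀ v, p (ψ v) = φ v := by
    have : p.comp ψ = φ := by
      ext i
      simp [ψ, hs]
    exact fun v => DFunLike.congr_fun this v
  set T := ψ '' S ∪ (fun z => z⁻¹ * ψ (w z)) '' Z
  set M := Subgroup.normalClosure T
  have hMp : M ≤ p.ker := by
    refine Subgroup.normalClosure_le_normal ?_
    rintro _ (⟨r, hr, rfl⟩ | ⟨z, -, rfl⟩)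
    · have : r ∈ φ.ker := hSφ ▸ Subgroup.subset_normalClosure hr
      simpa [MonoidHom.mem_ker, hψ] using this
    · simp [MonoidHom.mem_ker, hψ, hw]
  have hrange : Subgroup.comap (QuotientGroup.mk' M) ((QuotientGroup.mk' M).comp ψ).range = ⊤ := by
    rw [eq_top_iff, ← hZ, Subgroup.closure_le]
    intro z hz
    refine ⟨w z, (QuotientGroup.eq.2 ?_).symm⟩
    exact Subgroup.subset_normalClosure (Or.inr ⟨z, hz, rfl⟩)
  have hle : φ.ker ≤ M.comap ψ := by
    rw [← hSφ]
    refine Subgroup.normalClosure_le_normal fun r hr => ?_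
    exact Subgroup.subset_normalClosure (Or.inl ⟨r, hr, rfl⟩)
  refine ⟨T, (hS.image _).union (Z.finite_toSet.image _), le_antisymm hMp fun g hg => ?_⟩
  obtain ⟨v, hv⟩ : g ∈ Subgroup.comap (QuotientGroup.mk' M)
      ((QuotientGroup.mk' M).comp ψ).range := hrange ▸ Subgroup.mem_top g
  have hvg : (ψ v)⁻¹ * g ∈ M := QuotientGroup.eq.1 hv
  have hvk : v ∈ φ.ker := by
    have h1 := hMp hvg
    rw [MonoidHom.mem_ker] at hg h1 ⊢
    simpa [hψ, hg] using h1
  simpa using M.mul_mem (hle hvk) hvg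

/-- The normal closure of the images of `R` under the monoid generated by `η` and `τ`. -/
def endNormalClosure {F : Type*} [Group F] (η τ : Monoid.End F) (R : Set F) : Subgroup F :=
  Subgroup.normalClosure {w | ∃ φ ∈ Submonoid.closure ({η, τ} : Set (Monoid.End F)),
    ∃ r ∈ R, w = φ r}

namespace endNormalClosure

variable {F : Type*} [Group F] {η τ : Monoid.End F} {R : Set F}

instance : (endNormalClosure η τ R).Normal := Subgroup.normalClosure_normal

theorem subset : R ⊆ endNormalClosure η τ R := fun r hr =>
  Subgroup.subset_normalClosure ⟨1, one_mem _, r, hr, rfl⟩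

theorem mono {S : Set F} (h : R ⊆ S) : endNormalClosure η τ R ≤ endNormalClosure η τ S :=
  Subgroup.normalClosure_mono fun _ ⟨φ, hφ, r, hr, hw⟩ => ⟨φ, hφ, r, h hr, hw⟩

theorem le_comap {σ : Monoid.End F} (hσ : σ ∈ Submonoid.closure ({η, τ} : Set (Monoid.End F))) :
    endNormalClosure η τ R ≤ (endNormalClosure η τ R).comap (σ : F →* F) := by
  have : ((endNormalClosure η τ R).comap (σ : F →* F)).Normal :=
    Subgroup.Normal.comap inferInstance _
  refine Subgroup.normalClosure_le_normal ?_
  rintro _ ⟨φ, hφ, r, hr, rfl⟩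
  exact Subgroup.subset_normalClosure ⟨σ * φ, mul_mem hσ hφ, r, hr, rfl⟩

theorem le_comap_left : endNormalClosure η τ R ≤ (endNormalClosure η τ R).comap (η : F →* F) :=
  le_comap (Submonoid.subset_closure (by simp))

theorem le_comap_right : endNormalClosure η τ R ≤ (endNormalClosure η τ R).comap (τ : F →* F) :=
  le_comap (Submonoid.subset_closure (by simp))

theorem le_of_le_comap {N : Subgroup F} [N.Normal] (hη : N ≤ N.comap (η : F →* F))
    (hτ : N ≤ N.comap (τ : F →* F)) (hR : R ⊆ N) : endNormalClosure η τ R ≤ N := by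
  refine Subgroup.normalClosure_le_normal ?_
  rintro _ ⟨φ, hφ, r, hr, rfl⟩
  suffices h : ∀ x ∈ N, φ x ∈ N from h r (hR hr)
  induction hφ using Submonoid.closure_induction with
  | mem σ hσ =>
    rcases hσ with rfl | rfl
    · exact hη
    · exact hτ
  | one => exact fun x hx => hx
  | mul a b _ _ ha hb => exact fun x hx => ha _ (hb x hx)

end endNormalClosure

/-- If `π : F → G` is a homomorphism from a finitely generated free group such that `G` is the
semidirect product of `π.range` and `⟨t⟩ ≅ ℤ`, and `G` is finitely presented, then the kernel
of `π` is generated, as a normal subgroup invariant under endomorphisms `η` and `τ` lifting the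
conjugations by `t` and `t⁻¹`, by a finite set. -/
theorem exists_finset_ker_eq_endNormalClosure {G : Type*} [Group G] [Group.IsFinitelyPresented G]
    {n : ℕ} (π : FreeGroup (Fin n) →* G) (t : G) (η τ : Monoid.End (FreeGroup (Fin n)))
    (hη : ∀ x, π (η x) = t * π x * t⁻¹) (hτ : ∀ x, π (τ x) = t⁻¹ * π x * t)
    (hsurj : ∀ g, ∃ x, ∃ k : ℤ, π x * t ^ k = g)
    (hinj : ∀ x, ∀ k : ℤ, π x * t ^ k = 1 → k = 0) :
    ∃ R : Finset (FreeGroup (Fin n)), π.ker = endNormalClosure η τ (R : Set _) := by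
  classical
  have hkη : π.ker ≤ π.ker.comap (η : FreeGroup (Fin n) →* FreeGroup (Fin n)) := fun x hx => by
    have hx' : π x = 1 := hx
    change π (η x) = 1
    simp [hη, hx']
  have hkτ : π.ker ≤ π.ker.comap (τ : FreeGroup (Fin n) →* FreeGroup (Fin n)) := fun x hx => by
    have hx' : π x = 1 := hx
    change π (τ x) = 1
    simp [hτ, hx']
  let R₀ : Finset (FreeGroup (Fin n)) :=
    Finset.univ.image (fun i => (η (τ (FreeGroup.of i)))⁻¹ * FreeGroup.of i) ∪
      Finset.univ.image (fun i => (τ (η (FreeGroup.of i)))⁻¹ * FreeGroup.of i)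
  have hR₀ : (R₀ : Set (FreeGroup (Fin n))) ⊆ π.ker := by
    intro x hx
    simp only [R₀, Finset.coe_union, Finset.coe_image, Finset.coe_univ, Set.image_univ] at hx
    rcases hx with ⟨i, rfl⟩ | ⟨i, rfl⟩ <;> simp [MonoidHom.mem_ker, hη, hτ, mul_assoc]
  set N := endNormalClosure η τ (R₀ : Set (FreeGroup (Fin n)))
  have hNk : N ≤ π.ker := endNormalClosure.le_of_le_comap hkη hkτ hR₀
  let q := QuotientGroup.mk' N
  let a : (FreeGroup (Fin n) ⧸ N) →* (FreeGroup (Fin n) ⧸ N) :=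
    QuotientGroup.map N N η endNormalClosure.le_comap_left
  let b : (FreeGroup (Fin n) ⧸ N) →* (FreeGroup (Fin n) ⧸ N) :=
    QuotientGroup.map N N τ endNormalClosure.le_comap_right
  have hba : b.comp a = MonoidHom.id _ := by
    ext i
    refine QuotientGroup.eq.2 (endNormalClosure.subset (Finset.mem_union_right _ ?_))
    exact Finset.mem_image_of_mem _ (Finset.mem_univ i)
  have hab : a.comp b = MonoidHom.id _ := by
    ext i
    refine QuotientGroup.eq.2 (endNormalClosure.subset (Finset.mem_union_left _ ?_))
    exact Finset.mem_image_of_mem _ (Finset.mem_univ i)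
  let α : MulAut (FreeGroup (Fin n) ⧸ N) := a.toMulEquiv b hba hab
  have hα : ∀ x, α (q x) = q (η x) := fun x => rfl
  have hα' : ∀ x, α⁻¹ (q x) = q (τ x) := fun x => rfl
  let f : (FreeGroup (Fin n) ⧸ N) →* G := QuotientGroup.lift N π hNk
  have hf : ∀ x, f (q x) = π x := fun x => rfl
  have hfα : ∀ (k : ℤ) (y), f ((α ^ k) y) = t ^ k * f y * (t ^ k)⁻¹ := by
    intro k
    induction k using Int.induction_on with
    | zero => simp
    | succ k ih =>
      intro y
      obtain ⟨x, rfl⟩ := QuotientGroup.mk'_surjective N y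
      change f ((α ^ ((k : ℤ) + 1)) (q x)) = t ^ ((k : ℤ) + 1) * f (q x) * (t ^ ((k : ℤ) + 1))⁻¹
      rw [zpow_add_one, zpow_add_one, MulAut.mul_apply, ih, hα, hf, hf, hη]
      group
    | pred k ih =>
      intro y
      obtain ⟨x, rfl⟩ := QuotientGroup.mk'_surjective N y
      change f ((α ^ (-(k : ℤ) - 1)) (q x)) = t ^ (-(k : ℤ) - 1) * f (q x) * (t ^ (-(k : ℤ) - 1))⁻¹
      rw [zpow_sub_one, zpow_sub_one, MulAut.mul_apply, ih, hα', hf, hf, hτ]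
      group
  let act := zpowersHom (MulAut (FreeGroup (Fin n) ⧸ N)) α
  have hact : ∀ k y, act k y = (α ^ k.toAdd) y := fun k y => rfl
  let p : (FreeGroup (Fin n) ⧸ N) ⋊[act] Multiplicative ℤ →* G :=
    SemidirectProduct.lift f (zpowersHom G t) fun k => by
      refine MonoidHom.ext fun y => ?_
      exact hfα k.toAdd y
  have hp : ∀ x k, p (SemidirectProduct.inl (q x) * SemidirectProduct.inr k) =
      π x * t ^ k.toAdd := by
    intro x k
    simp [p, hf]
  have hpsurj : Function.Surjective p := by
    intro g
    obtain ⟨x, k, rfl⟩ := hsurj g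
    exact ⟨_, hp x (Multiplicative.ofAdd k)⟩
  have hFG : Group.FG ((FreeGroup (Fin n) ⧸ N) ⋊[act] Multiplicative ℤ) := by
    have : (⊤ : Subgroup ((FreeGroup (Fin n) ⧸ N) ⋊[act] Multiplicative ℤ)) =
        (SemidirectProduct.inl : _ →* (FreeGroup (Fin n) ⧸ N) ⋊[act] Multiplicative ℤ).range ⊔
        (SemidirectProduct.inr : _ →* (FreeGroup (Fin n) ⧸ N) ⋊[act] Multiplicative ℤ).range := by
      refine (eq_top_iff.2 fun g _ => ?_).symm
      rw [← SemidirectProduct.inl_left_mul_inr_right g]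
      exact Subgroup.mul_mem_sup ⟨_, rfl⟩ ⟨_, rfl⟩
    refine ⟨this ▸ Subgroup.FG.sup ?_ ?_⟩
    · exact (Group.fg_iff_subgroup_fg _).1 inferInstance
    · exact (Group.fg_iff_subgroup_fg _).1 inferInstance
  obtain ⟨T, hT, hTp⟩ := p.isFinitelyNormallyGenerated_ker hpsurj
  have hTq : ∀ g ∈ p.ker, ∃ x ∈ π.ker, SemidirectProduct.inl (q x) = g := by
    intro g hg
    obtain ⟨x, hx⟩ := QuotientGroup.mk'_surjective N g.left
    have hg' : SemidirectProduct.inl (q x) * SemidirectProduct.inr g.right = g := by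
      change SemidirectProduct.inl (QuotientGroup.mk' N x) * _ = g
      rw [hx, SemidirectProduct.inl_left_mul_inr_right]
    have h1 : π x * t ^ g.right.toAdd = 1 := by
      rw [← hp, hg']
      exact hg
    have h0 := hinj _ _ h1
    have h2 : g.right = 1 := h0
    refine ⟨x, by simpa [h0] using h1, ?_⟩
    simpa [h2] using hg'
  choose! s hsk hs using hTq
  have hTk : ∀ g ∈ T, g ∈ p.ker := fun g hg => hTp ▸ Subgroup.subset_normalClosure hg
  refine ⟨R₀ ∪ hT.toFinset.image s, le_antisymm ?_ ?_⟩
  · set N₁ := endNormalClosure η τ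
      ((R₀ ∪ hT.toFinset.image s : Finset (FreeGroup (Fin n))) : Set (FreeGroup (Fin n)))
    have hle : N ≤ N₁ := endNormalClosure.mono (by simp)
    have hαL : ∀ (k : ℤ), ∀ y ∈ N₁.map q, (α ^ k) y ∈ N₁.map q := by
      intro k
      induction k using Int.induction_on with
      | zero => simp
      | succ k ih =>
        rintro _ ⟨x, hx, rfl⟩
        rw [zpow_add_one]
        exact ih _ ⟨η x, endNormalClosure.le_comap_left hx, rfl⟩
      | pred k ih =>
        rintro _ ⟨x, hx, rfl⟩
        rw [zpow_sub_one]
        exact ih _ ⟨τ x, endNormalClosure.le_comap_right hx, rfl⟩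
    have hLn : (N₁.map q).Normal :=
      Subgroup.Normal.map inferInstance q (QuotientGroup.mk'_surjective N)
    let P : Subgroup ((FreeGroup (Fin n) ⧸ N) ⋊[act] Multiplicative ℤ) :=
      (N₁.map q).map SemidirectProduct.inl
    have hPn : P.Normal := by
      constructor
      rintro _ ⟨y, hy, rfl⟩ ⟨l, k⟩
      refine ⟨l * (α ^ k.toAdd) y * l⁻¹, hLn.conj_mem _ (hαL _ _ hy) _, ?_⟩
      rw [← hact, SemidirectProduct.mk_eq_inl_mul_inr]
      simp [SemidirectProduct.inl_aut, mul_assoc]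
    have hpP : p.ker ≤ P := by
      rw [← hTp]
      refine Subgroup.normalClosure_le_normal fun g hg => ?_
      refine ⟨q (s g), ⟨s g, endNormalClosure.subset ?_, rfl⟩, hs g (hTk g hg)⟩
      simp only [Finset.coe_union, Finset.coe_image, Set.Finite.coe_toFinset]
      exact Or.inr ⟨g, hg, rfl⟩
    intro x hx
    have hx' : SemidirectProduct.inl (q x) ∈ p.ker := by
      have := hp x 1
      rw [map_one, mul_one] at this
      rw [MonoidHom.mem_ker, this]
      simpa using hx
    obtain ⟨_, ⟨z, hz, rfl⟩, hzx⟩ := hpP hx'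
    have h1 : z⁻¹ * x ∈ N := QuotientGroup.eq.1 (SemidirectProduct.inl_injective hzx)
    simpa using N₁.mul_mem hz (hle h1)
  · refine endNormalClosure.le_of_le_comap hkη hkτ ?_
    simp only [Finset.coe_union, Finset.coe_image, Set.Finite.coe_toFinset, Set.union_subset_iff]
    refine ⟨hR₀, ?_⟩
    rintro _ ⟨g, hg, rfl⟩
    exact hsk g (hTk g hg)

/-- **Theorem 1.** If `G` is a finitely presented group with a finitely generated normal
subgroup `H` such that `G/H` is infinite cyclic, then `H` has an ascending finite
endomorphic presentation with two free-group endomorphisms. -/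
theorem ascending_LPresentation_of_fp_infinite_cyclic_quotient {G : Type*} [Group G]
    (hG : IsFinitelyPresentedGroup G) (H : Subgroup G) [H.Normal] (hH : H.FG)
    (hcyc : Nonempty ((G ⧸ H) ≃* Multiplicative ℤ)) :
    HasAscendingFiniteLPresentationTwo H := by
  obtain ⟨e⟩ := hcyc
  have hfp : Group.IsFinitelyPresented G := by
    obtain ⟨m, S, ⟨i⟩⟩ := hG
    have := Group.IsFinitelyPresented.quotient
      (Subgroup.normalClosure (S : Set (FreeGroup (Fin m))))
      ⟨(S : Set (FreeGroup (Fin m))), S.finite_toSet, rfl⟩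
    exact Group.IsFinitelyPresented.equiv i.symm
  obtain ⟨n, ρ, hρ⟩ : ∃ (n : ℕ) (ρ : FreeGroup (Fin n) →* H), Function.Surjective ρ := by
    obtain ⟨A, _, φ, hφ⟩ := Group.fg_iff_exists_freeGroup_hom_surjective_finite.1
      ((Group.fg_iff_subgroup_fg H).2 hH)
    obtain ⟨n, ⟨i⟩⟩ := Finite.exists_equiv_fin A
    exact ⟨n, φ.comp (FreeGroup.freeGroupCongr i).symm.toMonoidHom,
      hφ.comp (FreeGroup.freeGroupCongr i).symm.surjective⟩
  let d : G →* Multiplicative ℤ := e.toMonoidHom.comp (QuotientGroup.mk' H)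
  have hd : ∀ g, d g = 1 ↔ g ∈ H := fun g => by simp [d]
  obtain ⟨t, ht⟩ : ∃ t, d t = Multiplicative.ofAdd 1 :=
    (e.surjective.comp (QuotientGroup.mk'_surjective H)) _
  have hdt : ∀ k : ℤ, d (t ^ k) = Multiplicative.ofAdd k := fun k => by
    rw [map_zpow, ht, ← ofAdd_zsmul]
    simp
  choose s hs using hρ
  have hlift : ∀ c : G, ∃ σ : Monoid.End (FreeGroup (Fin n)),
      ∀ x, (ρ (σ x) : G) = c * ρ x * c⁻¹ := by
    intro c
    let σ : FreeGroup (Fin n) →* FreeGroup (Fin n) :=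
      FreeGroup.lift fun i => s (MulAut.conjNormal c (ρ (FreeGroup.of i)))
    have hσ : ρ.comp σ = (MulAut.conjNormal c : MulAut H).toMonoidHom.comp ρ := by
      ext i
      simp [σ, hs]
    exact ⟨σ, fun x => congrArg Subtype.val (DFunLike.congr_fun hσ x)⟩
  obtain ⟨η, hη⟩ := hlift t
  obtain ⟨τ, hτ⟩ := hlift t⁻¹
  obtain ⟨R, hR⟩ := exists_finset_ker_eq_endNormalClosure (H.subtype.comp ρ) t η τ hη
    (fun x => by simpa using hτ x)
    (fun g => by
      have hg : g * (t ^ (d g).toAdd)⁻¹ ∈ H := by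
        rw [← hd, map_mul, map_inv, hdt]
        simp
      refine ⟨s ⟨_, hg⟩, (d g).toAdd, ?_⟩
      simp [hs])
    (fun x k hk => by
      have h1 := congrArg d hk
      rw [map_mul, hdt, (hd ((H.subtype.comp ρ) x)).2 (ρ x).2, one_mul, map_one] at h1
      exact h1)
  have hker : ρ.ker = endNormalClosure η τ (R : Set (FreeGroup (Fin n))) := by
    rw [← hR]
    ext x
    simp [MonoidHom.mem_ker]
  exact ⟨n, R, η, τ, ⟨(QuotientGroup.quotientKerEquivOfSurjective ρ fun h => ⟨s h, hs h⟩).symm.trans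
    (QuotientGroup.quotientMulEquivOfEq hker)⟩⟩
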